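/- arXiv:2502.02064 — 2 statements merged into one kernel-verified Lean document; each statement's English description precedes it below -/
import Mathlib

section
/- Let α ∈ (0,∞) and let N ∈ ℕ be such that e^{αn/2}/n ≥ 2 for all n ≥ N. Let Υ(α,N) = {x ∈ (0,1) irrational : e^{−α/4} < a_n(x)/e^{αn/2} < e^{−α/4} + 1/n for all n ≥ N}. Then the Hausdorff dimension of Υ(α,N) is at least 1/2. -/
open Filter Set
open scoped ENNReal

/-- The Gauss map. -/
noncomputable def gaussMap (x : ℝ) : ℝ := Int.fract (1 / x)

/-- The `n`-th partial quotient `a_n(x)` (for `n ≥ 1`) of the continued fraction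
expansion of `x ∈ (0,1)`. -/
noncomputable def pq (x : ℝ) (n : ℕ) : ℕ := ⌊1 / (gaussMap^[n - 1] x)⌋₊

/-- `L_n(x) = max_{1 ≤ i ≤ n} a_i(x) a_{i+1}(x)`. -/
noncomputable def Lmax (x : ℝ) (n : ℕ) : ℕ :=
  (Finset.Icc 1 n).sup fun i => pq x i * pq x (i + 1)

/-- The level set `L(φ)` of irrational `x ∈ (0,1)` with `L_n(x)/φ(n) → 1`. -/
def Lset (φ : ℕ → ℝ) : Set ℝ :=
  {x | x ∈ Ioo (0 : ℝ) 1 ∧ Irrational x ∧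
    Tendsto (fun n => (Lmax x n : ℝ) / φ n) atTop (nhds 1)}

/-- `f` is regularly increasing with (finite) index `ρ`. -/
def RegInc (f : ℝ → ℝ) (ρ : ℝ) : Prop :=
  ∃ c > (0 : ℝ), ∃ f' : ℝ → ℝ,
    (∀ x ∈ Ici c, 0 < f x) ∧
    (∀ x ∈ Ici c, HasDerivAt f (f' x) x) ∧
    ContinuousOn f' (Ici c) ∧
    (∀ x ∈ Ici c, 0 < f' x) ∧
    Tendsto f atTop atTop ∧
    Tendsto (fun x => x * f' x / f x) atTop (nhds ρ)

/-- `f` is regularly increasing with index `∞`. -/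
def RegIncTop (f : ℝ → ℝ) : Prop :=
  ∃ c > (0 : ℝ), ∃ f' : ℝ → ℝ,
    (∀ x ∈ Ici c, 0 < f x) ∧
    (∀ x ∈ Ici c, HasDerivAt f (f' x) x) ∧
    ContinuousOn f' (Ici c) ∧
    (∀ x ∈ Ici c, 0 < f' x) ∧
    Tendsto f atTop atTop ∧
    Tendsto (fun x => x * f' x / f x) atTop atTop

/-- The `n`-th convergent of the continued fraction `[a 0, a 1, …]`. -/
noncomputable def cfConv : ℕ → (ℕ → ℕ) → ℝ
  | 0, _ => 0
  | n + 1, a => 1 / (a 0 + cfConv n fun i => a (i + 1))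

theorem cfConv_nonneg (n : ℕ) (a : ℕ → ℕ) : 0 ≤ cfConv n a := by
  induction n generalizing a with
  | zero => exact le_rfl
  | succ n ih =>
    have := ih fun i => a (i + 1)
    rw [cfConv]
    positivity

theorem abs_one_div_sub_one_div {u v : ℝ} (hu : 0 < u) (hv : 0 < v) :
    |1 / u - 1 / v| = |u - v| / (u * v) := by
  rw [div_sub_div _ _ hu.ne' hv.ne', abs_div, abs_of_pos (mul_pos hu hv), one_mul, mul_one,
    abs_sub_comm]

theorem dist_cfConv_succ_le (n : ℕ) (a : ℕ → ℕ) (ha : ∀ i, 2 ≤ a i) :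
    dist (cfConv n a) (cfConv (n + 1) a) ≤ 1 * (1 / 4 : ℝ) ^ n := by
  induction n generalizing a with
  | zero =>
    have h : (2 : ℝ) ≤ a 0 := by exact_mod_cast ha 0
    simp only [cfConv, Real.dist_eq, zero_sub, abs_neg, add_zero, pow_zero, mul_one]
    rw [abs_of_nonneg (by positivity), div_le_one (by positivity)]
    linarith
  | succ n ih =>
    have h : (2 : ℝ) ≤ a 0 := by exact_mod_cast ha 0
    have ih := ih (fun i => a (i + 1)) fun i => ha _
    have h1 := cfConv_nonneg n fun i => a (i + 1)
    have h2 := cfConv_nonneg (n + 1) fun i => a (i + 1)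
    rw [cfConv, cfConv, Real.dist_eq, abs_one_div_sub_one_div (by linarith) (by linarith),
      add_sub_add_left_eq_sub]
    rw [Real.dist_eq] at ih
    rw [div_le_iff₀ (by nlinarith), pow_succ]
    have : (0 : ℝ) ≤ (1 / 4) ^ n := by positivity
    have h4 : 4 ≤ ((a 0 : ℝ) + cfConv n fun i => a (i + 1)) *
        (a 0 + cfConv (n + 1) fun i => a (i + 1)) := by nlinarith
    nlinarith

/-- The value of the infinite continued fraction `[a 0, a 1, …]`. -/
noncomputable def cfValue (a : ℕ → ℕ) : ℝ := limUnder atTop fun n => cfConv n a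

theorem tendsto_cfConv {a : ℕ → ℕ} (ha : ∀ i, 2 ≤ a i) :
    Tendsto (fun n => cfConv n a) atTop (nhds (cfValue a)) :=
  (cauchySeq_of_le_geometric _ _ (by norm_num) fun n => dist_cfConv_succ_le n a ha).tendsto_limUnder

theorem cfValue_nonneg {a : ℕ → ℕ} (ha : ∀ i, 2 ≤ a i) : 0 ≤ cfValue a :=
  ge_of_tendsto' (tendsto_cfConv ha) fun n => cfConv_nonneg n a

theorem cfValue_eq {a : ℕ → ℕ} (ha : ∀ i, 2 ≤ a i) :
    cfValue a = 1 / (a 0 + cfValue fun i => a (i + 1)) := by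
  have h : (2 : ℝ) ≤ a 0 := by exact_mod_cast ha 0
  have h1 : 0 ≤ cfValue fun i => a (i + 1) := cfValue_nonneg fun i => ha _
  refine tendsto_nhds_unique ((tendsto_add_atTop_iff_nat 1).2 (tendsto_cfConv ha)) ?_
  simp only [cfConv]
  exact tendsto_const_nhds.div (tendsto_const_nhds.add (tendsto_cfConv fun i => ha _))
    (by positivity)

theorem cfValue_pos {a : ℕ → ℕ} (ha : ∀ i, 2 ≤ a i) : 0 < cfValue a := by
  have h : (2 : ℝ) ≤ a 0 := by exact_mod_cast ha 0
  have h1 : 0 ≤ cfValue fun i => a (i + 1) := cfValue_nonneg fun i => ha _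
  rw [cfValue_eq ha]
  positivity

theorem cfValue_le_half {a : ℕ → ℕ} (ha : ∀ i, 2 ≤ a i) : cfValue a ≤ 1 / 2 := by
  have h : (2 : ℝ) ≤ a 0 := by exact_mod_cast ha 0
  have h1 : 0 ≤ cfValue fun i => a (i + 1) := cfValue_nonneg fun i => ha _
  rw [cfValue_eq ha]
  exact one_div_le_one_div_of_le two_pos (by linarith)

theorem one_div_cfValue {a : ℕ → ℕ} (ha : ∀ i, 2 ≤ a i) :
    1 / cfValue a = a 0 + cfValue fun i => a (i + 1) := by
  rw [cfValue_eq ha, one_div_one_div]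

theorem gaussMap_cfValue {a : ℕ → ℕ} (ha : ∀ i, 2 ≤ a i) :
    gaussMap (cfValue a) = cfValue fun i => a (i + 1) := by
  have h1 : cfValue (fun i => a (i + 1)) ≤ 1 / 2 := cfValue_le_half fun i => ha _
  rw [gaussMap, one_div_cfValue ha, Int.fract_natCast_add, Int.fract_eq_self]
  exact ⟨cfValue_nonneg fun i => ha _, by linarith⟩

theorem gaussMap_iterate_cfValue (n : ℕ) {a : ℕ → ℕ} (ha : ∀ i, 2 ≤ a i) :
    gaussMap^[n] (cfValue a) = cfValue fun i => a (i + n) := by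
  induction n generalizing a with
  | zero => rfl
  | succ n ih =>
    rw [Function.iterate_succ_apply, gaussMap_cfValue ha, ih fun i => ha _]
    simp only [add_assoc]

theorem pq_cfValue (n : ℕ) {a : ℕ → ℕ} (ha : ∀ i, 2 ≤ a i) :
    pq (cfValue a) n = a (n - 1) := by
  have h1 : cfValue (fun i => a (i + 1 + (n - 1))) ≤ 1 / 2 := cfValue_le_half fun i => ha _
  have h0 : 0 ≤ cfValue (fun i => a (i + 1 + (n - 1))) := cfValue_nonneg fun i => ha _
  rw [pq, gaussMap_iterate_cfValue _ ha, one_div_cfValue fun i => ha _, zero_add,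
    Nat.floor_eq_iff (by positivity)]
  exact ⟨by linarith, by linarith⟩

theorem cfValue_ne_div (q : ℕ) : ∀ (p : ℕ) (a : ℕ → ℕ), (∀ i, 2 ≤ a i) →
    cfValue a ≠ p / q := by
  induction q using Nat.strong_induction_on with
  | _ q ih =>
    intro p a ha h
    have hpos := cfValue_pos ha
    have hhalf := cfValue_le_half ha
    have htail : 0 ≤ cfValue (fun i => a (i + 1)) := cfValue_nonneg fun i => ha _
    have hq : (0 : ℝ) < q := by
      rcases Nat.eq_zero_or_pos q with rfl | hq
      · simp [h] at hpos
      · exact_mod_cast hq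
    have hp : (0 : ℝ) < p := by
      rw [h] at hpos
      exact (div_pos_iff_of_pos_right hq).1 hpos
    have hpq : p < q := by
      rw [h, div_le_iff₀ hq] at hhalf
      exact_mod_cast (by linarith : (p : ℝ) < q)
    have hinv := one_div_cfValue ha
    rw [h, one_div_div] at hinv
    have hle : a 0 * p ≤ q := by
      have : (a 0 : ℝ) ≤ q / p := by linarith
      rw [le_div_iff₀ hp] at this
      exact_mod_cast this
    refine ih p hpq (q - a 0 * p) (fun i => a (i + 1)) (fun i => ha _) ?_
    rw [Nat.cast_sub hle, eq_div_iff hp.ne', ← sub_eq_iff_eq_add'.2 hinv]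
    push_cast
    field_simp

theorem irrational_cfValue {a : ℕ → ℕ} (ha : ∀ i, 2 ≤ a i) : Irrational (cfValue a) := by
  rintro ⟨q, hq⟩
  have h0 : 0 ≤ q.num := Rat.num_nonneg.2 (by exact_mod_cast hq ▸ cfValue_nonneg ha)
  refine cfValue_ne_div q.den q.num.toNat a ha ?_
  rw [← hq, Rat.cast_def]
  congr 1
  exact_mod_cast (Int.toNat_of_nonneg h0).symm

/-- Two continued fractions which first differ at the partial quotient `n` are separated in terms
of an upper bound `A` for their partial quotients. -/
theorem inv_prod_le_abs_cfValue_sub (n : ℕ) {a b A : ℕ → ℕ} (ha : ∀ i, 2 ≤ a i)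
    (hb : ∀ i, 2 ≤ b i) (haA : ∀ i, a i ≤ A i) (hbA : ∀ i, b i ≤ A i)
    (hab : ∀ i < n, a i = b i) (hn : a n ≠ b n) :
    1 / 2 * ((∏ i ∈ Finset.range (n + 1), ((A i : ℝ) + 1)) ^ 2)⁻¹ ≤
      |cfValue a - cfValue b| := by
  have ha0 : (2 : ℝ) ≤ a 0 := by exact_mod_cast ha 0
  have hb0 : (2 : ℝ) ≤ b 0 := by exact_mod_cast hb 0
  have haA0 : (a 0 : ℝ) ≤ A 0 := by exact_mod_cast haA 0
  have hbA0 : (b 0 : ℝ) ≤ A 0 := by exact_mod_cast hbA 0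
  have hu0 : 0 ≤ cfValue (fun i => a (i + 1)) := cfValue_nonneg fun i => ha _
  have hv0 : 0 ≤ cfValue (fun i => b (i + 1)) := cfValue_nonneg fun i => hb _
  have hu1 : cfValue (fun i => a (i + 1)) ≤ 1 / 2 := cfValue_le_half fun i => ha _
  have hv1 : cfValue (fun i => b (i + 1)) ≤ 1 / 2 := cfValue_le_half fun i => hb _
  have key : |(a 0 + cfValue fun i => a (i + 1)) - (b 0 + cfValue fun i => b (i + 1))| *
      (((A 0 : ℝ) + 1) ^ 2)⁻¹ ≤ |cfValue a - cfValue b| := by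
    rw [cfValue_eq ha, cfValue_eq hb, abs_one_div_sub_one_div (by linarith) (by linarith),
      div_eq_mul_inv, sq]
    gcongr <;> linarith
  refine le_trans ?_ key
  rw [Finset.prod_range_succ', mul_pow, mul_inv, ← mul_assoc]
  gcongr
  cases n with
  | zero =>
    have hle : (1 : ℝ) ≤ |(a 0 : ℝ) - b 0| := by
      have : (1 : ℤ) ≤ |(a 0 : ℤ) - b 0| := Int.one_le_abs (by omega)
      exact_mod_cast this
    have htri := abs_sub_abs_le_abs_sub ((a 0 : ℝ) - b 0)
      ((cfValue fun i => b (i + 1)) - cfValue fun i => a (i + 1))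
    have hlt : |(cfValue fun i => b (i + 1)) - cfValue fun i => a (i + 1)| ≤ 1 / 2 :=
      abs_le.2 ⟨by linarith, by linarith⟩
    rw [Finset.prod_range_zero, one_pow, inv_one, mul_one]
    calc (1 : ℝ) / 2 ≤ _ := by linarith
      _ ≤ _ := htri
      _ = _ := by ring_nf
  | succ n =>
    have ih := inv_prod_le_abs_cfValue_sub n (a := fun i => a (i + 1)) (b := fun i => b (i + 1))
      (A := fun i => A (i + 1)) (fun i => ha _) (fun i => hb _) (fun i => haA _) (fun i => hbA _)
      (fun i hi => hab _ (by omega)) hn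
    rw [hab 0 (by omega), add_sub_add_left_eq_sub]
    exact ih

theorem le_dimH_image_of_holder_inverse {g : ℝ → ℝ} {C r : NNReal} (hr : 0 < r)
    (h : ∀ y ∈ Ico (0 : ℝ) 1, ∀ z ∈ Ico (0 : ℝ) 1, |y - z| ≤ C * |g y - g z| ^ (r : ℝ)) :
    (r : ℝ≥0∞) ≤ dimH (g '' Ico (0 : ℝ) 1) := by
  have hinj : InjOn g (Ico 0 1) := fun y hy z hz hyz => by
    have := h y hy z hz
    rw [hyz, sub_self, abs_zero, Real.zero_rpow (by exact_mod_cast hr.ne'), mul_zero] at this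
    exact sub_eq_zero.1 (abs_nonpos_iff.1 this)
  have hholder : HolderOnWith C r (Function.invFunOn g (Ico (0 : ℝ) 1)) (g '' Ico (0 : ℝ) 1) := by
    rintro _ ⟨y, hy, rfl⟩ _ ⟨z, hz, rfl⟩
    rw [hinj.leftInvOn_invFunOn hy, hinj.leftInvOn_invFunOn hz, edist_dist, edist_dist,
      Real.dist_eq, Real.dist_eq, ENNReal.ofReal_rpow_of_nonneg (abs_nonneg _) r.coe_nonneg,
      ← ENNReal.ofReal_coe_nnreal (p := C), ← ENNReal.ofReal_mul C.coe_nonneg]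
    exact ENNReal.ofReal_le_ofReal (h y hy z hz)
  have hdim := hholder.dimH_image_le hr
  rw [hinj.leftInvOn_invFunOn.image_image,
    Real.dimH_of_mem_nhds (Ico_mem_nhds (by norm_num : (0 : ℝ) < 1 / 2) (by norm_num)),
    Module.finrank_self, Nat.cast_one,
    ENNReal.le_div_iff_mul_le (Or.inl (by exact_mod_cast hr.ne')) (Or.inl ENNReal.coe_ne_top),
    one_mul] at hdim
  exact hdim

/-- The digit with index `n` of `y` in the mixed radix `M`. -/
noncomputable def radixDigit (M : ℕ → ℕ) (y : ℝ) (n : ℕ) : ℕ :=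
  ⌊y * (∏ i ∈ Finset.range (n + 1), M i : ℕ)⌋₊ % M n

theorem floor_mul_prod_eq_of_radixDigit_eq {M : ℕ → ℕ} (hM : ∀ i, 1 ≤ M i) {y z : ℝ}
    (hy : y ∈ Ico (0 : ℝ) 1) (hz : z ∈ Ico (0 : ℝ) 1) (n : ℕ)
    (h : ∀ i < n, radixDigit M y i = radixDigit M z i) :
    ⌊y * (∏ i ∈ Finset.range n, M i : ℕ)⌋₊ = ⌊z * (∏ i ∈ Finset.range n, M i : ℕ)⌋₊ := by
  induction n with
  | zero => simp [Nat.floor_eq_zero.2 hy.2, Nat.floor_eq_zero.2 hz.2]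
  | succ n ih =>
    have hdiv (w : ℝ) : ⌊w * (∏ i ∈ Finset.range (n + 1), M i : ℕ)⌋₊ / M n =
        ⌊w * (∏ i ∈ Finset.range n, M i : ℕ)⌋₊ := by
      have : (M n : ℝ) ≠ 0 := Nat.cast_ne_zero.2 (Nat.one_le_iff_ne_zero.1 (hM n))
      rw [← Nat.floor_div_natCast, Finset.prod_range_succ, Nat.cast_mul, ← mul_assoc,
        mul_div_cancel_right₀ _ this]
    have hmod := h n n.lt_succ_self
    have ih := ih fun i hi => h i (hi.trans n.lt_succ_self)
    rw [← hdiv, ← hdiv] at ih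
    rw [← Nat.div_add_mod ⌊y * (∏ i ∈ Finset.range (n + 1), M i : ℕ)⌋₊ (M n), ih]
    unfold radixDigit at hmod
    rw [hmod, Nat.div_add_mod]

theorem abs_sub_mul_prod_lt_one {M : ℕ → ℕ} (hM : ∀ i, 1 ≤ M i) {y z : ℝ}
    (hy : y ∈ Ico (0 : ℝ) 1) (hz : z ∈ Ico (0 : ℝ) 1) (n : ℕ)
    (h : ∀ i < n, radixDigit M y i = radixDigit M z i) :
    |y - z| * (∏ i ∈ Finset.range n, M i : ℕ) < 1 := by
  have hfloor := floor_mul_prod_eq_of_radixDigit_eq hM hy hz n h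
  set P : ℕ := ∏ i ∈ Finset.range n, M i
  have hP : (0 : ℝ) ≤ P := P.cast_nonneg
  have hy1 := Nat.floor_le (mul_nonneg hy.1 hP)
  have hz1 := Nat.floor_le (mul_nonneg hz.1 hP)
  have hy2 := Nat.lt_floor_add_one (y * P)
  have hz2 := Nat.lt_floor_add_one (z * P)
  rw [hfloor] at hy1 hy2
  rw [← abs_of_nonneg hP, ← abs_mul, sub_mul, abs_lt]
  constructor <;> linarith

theorem exists_forall_le_of_eventually_succ_le {u : ℕ → ℝ}
    (h : ∀ᶠ n in atTop, u (n + 1) ≤ u n) : ∃ C, ∀ n, u n ≤ C := by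
  obtain ⟨k, hk⟩ := eventually_atTop.1 h
  have hle : ∀ n ≤ k, u n ≤ ∑ i ∈ Finset.range (k + 1), |u i| := fun n hn =>
    (le_abs_self _).trans (Finset.single_le_sum (f := fun i => |u i|) (fun i _ => abs_nonneg _)
      (Finset.mem_range.2 (by omega)))
  refine ⟨∑ i ∈ Finset.range (k + 1), |u i|, fun n => ?_⟩
  rcases le_total n k with hn | hn
  · exact hle n hn
  · induction n, hn using Nat.le_induction with
    | base => exact hle k le_rfl
    | succ n hn ih => exact (hk n hn).trans ih

theorem exists_prod_rpow_le {A : ℕ → ℝ} {M : ℕ → ℕ} (hA : ∀ i, 0 < A i) (hM : ∀ i, 1 ≤ M i)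
    {t : ℝ} (h : ∀ᶠ n in atTop, A (n + 1) ^ t ≤ M n) :
    ∃ C > (0 : ℝ), ∀ n, (∏ i ∈ Finset.range (n + 1), A i) ^ t ≤
      C * (∏ i ∈ Finset.range n, M i : ℕ) := by
  have hPpos (n : ℕ) : (0 : ℝ) < (∏ i ∈ Finset.range n, M i : ℕ) := by
    exact_mod_cast Finset.prod_pos fun i _ => hM i
  obtain ⟨C, hC⟩ := exists_forall_le_of_eventually_succ_le
    (u := fun n => (∏ i ∈ Finset.range (n + 1), A i) ^ t / (∏ i ∈ Finset.range n, M i : ℕ)) (by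
      filter_upwards [h] with n hn
      have hQ : 0 < ∏ i ∈ Finset.range (n + 1), A i := Finset.prod_pos fun i _ => hA i
      rw [Finset.prod_range_succ A (n + 1), Finset.prod_range_succ M n, Nat.cast_mul,
        Real.mul_rpow hQ.le (hA _).le, mul_div_mul_comm]
      refine mul_le_of_le_one_right (by positivity) (div_le_one_of_le₀ hn (Nat.cast_nonneg _)))
  refine ⟨max C 1, by positivity, fun n => ?_⟩
  rw [← div_le_iff₀ (hPpos n)]
  exact (hC n).trans (le_max_left _ _)

theorem ofReal_half_le_dimH_cfValue {b M : ℕ → ℕ} (hb : ∀ i, 2 ≤ b i) (hM : ∀ i, 1 ≤ M i)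
    {t : ℝ} (ht : 0 < t)
    (h : ∀ᶠ n in atTop, ((b (n + 1) : ℝ) + M (n + 1) + 1) ^ t ≤ M n) :
    ENNReal.ofReal (t / 2) ≤
      dimH {x | ∃ d : ℕ → ℕ, (∀ i, d i < M i) ∧ cfValue (fun i => b i + d i) = x} := by
  obtain ⟨C, hC0, hC⟩ := exists_prod_rpow_le (A := fun i => (b i : ℝ) + M i + 1)
    (fun i => by positivity) hM h
  set g : ℝ → ℝ := fun y => cfValue fun i => b i + radixDigit M y i
  have hdigit (y : ℝ) (i : ℕ) : radixDigit M y i < M i := Nat.mod_lt _ (hM i)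
  refine le_trans ?_ (dimH_mono (s := g '' Ico (0 : ℝ) 1) ?_)
  swap
  · rintro _ ⟨y, -, rfl⟩
    exact ⟨_, hdigit y, rfl⟩
  refine le_dimH_image_of_holder_inverse (C := (C * 2 ^ (t / 2)).toNNReal)
    (Real.toNNReal_pos.2 (by positivity)) fun y hy z hz => ?_
  rw [Real.coe_toNNReal _ (by positivity), Real.coe_toNNReal _ (by positivity)]
  have hex : y ≠ z → ∃ n, radixDigit M y n ≠ radixDigit M z n := by
    intro hyz
    by_contra! hall
    have hpos : 0 < |y - z| := abs_pos.2 (sub_ne_zero.2 hyz)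
    obtain ⟨n, hn⟩ := pow_unbounded_of_one_lt (C / |y - z|) (Real.one_lt_rpow one_lt_two ht)
    have hlt := abs_sub_mul_prod_lt_one hM hy hz n fun i _ => hall i
    have hpow : ((2 : ℝ) ^ t) ^ n ≤ (∏ i ∈ Finset.range (n + 1), ((b i : ℝ) + M i + 1)) ^ t := by
      rw [← Real.rpow_mul_natCast zero_le_two, mul_comm, Real.rpow_natCast_mul zero_le_two]
      refine Real.rpow_le_rpow (by positivity) ?_ ht.le
      have hle (i : ℕ) : (2 : ℝ) ≤ (b i : ℝ) + M i + 1 := by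
        have : (2 : ℝ) ≤ b i := by exact_mod_cast hb i
        have : (0 : ℝ) ≤ M i := Nat.cast_nonneg _
        linarith
      calc (2 : ℝ) ^ n ≤ 2 ^ (n + 1) := pow_le_pow_right₀ one_le_two n.le_succ
        _ = ∏ i ∈ Finset.range (n + 1), (2 : ℝ) := by simp
        _ ≤ _ := Finset.prod_le_prod (fun _ _ => zero_le_two) fun i _ => hle i
    rw [div_lt_iff₀ hpos] at hn
    have := hC n
    nlinarith
  rcases eq_or_ne y z with rfl | hyz
  · rw [sub_self, abs_zero]
    positivity
  obtain ⟨n, hn, hmin⟩ : ∃ n, radixDigit M y n ≠ radixDigit M z n ∧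
      ∀ i < n, radixDigit M y i = radixDigit M z i :=
    ⟨Nat.find (hex hyz), Nat.find_spec (hex hyz), fun i hi => not_not.1 (Nat.find_min _ hi)⟩
  have hlt := abs_sub_mul_prod_lt_one hM hy hz n hmin
  have hsep := inv_prod_le_abs_cfValue_sub n (a := fun i => b i + radixDigit M y i)
    (b := fun i => b i + radixDigit M z i) (A := fun i => b i + M i)
    (fun i => (hb i).trans (Nat.le_add_right _ _)) (fun i => (hb i).trans (Nat.le_add_right _ _))
    (fun i => Nat.add_le_add_left (hdigit y i).le _)
    (fun i => Nat.add_le_add_left (hdigit z i).le _)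
    (fun i hi => by rw [hmin i hi]) (by simpa using hn)
  have hCn := hC n
  push_cast at hsep
  set Q : ℝ := ∏ i ∈ Finset.range (n + 1), ((b i : ℝ) + M i + 1)
  have hQ : 0 < Q := Finset.prod_pos fun i _ => by positivity
  have hsep' : (Q ^ t)⁻¹ ≤ 2 ^ (t / 2) * |g y - g z| ^ (t / 2) := by
    rw [← Real.mul_rpow zero_le_two (abs_nonneg _), ← Real.inv_rpow hQ.le]
    calc Q⁻¹ ^ t = ((Q ^ 2)⁻¹) ^ (t / 2) := by
          rw [← inv_pow, ← Real.rpow_natCast_mul (by positivity)]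
          congr 1
          push_cast
          ring
      _ ≤ _ := Real.rpow_le_rpow (by positivity) (by linarith) (by positivity)
  have hQt : 0 < Q ^ t := Real.rpow_pos_of_pos hQ t
  calc |y - z| ≤ C * (Q ^ t)⁻¹ := by
        rw [← div_eq_mul_inv, le_div_iff₀ hQt]
        have := mul_le_mul_of_nonneg_left hCn (abs_nonneg (y - z))
        nlinarith
    _ ≤ C * (2 ^ (t / 2) * |g y - g z| ^ (t / 2)) := by gcongr
    _ = _ := by ring

theorem eventually_rpow_add_one_le_exp_div {α t : ℝ} (hα : 0 < α) (ht0 : 0 ≤ t) (ht : t < 1)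
    {K : ℝ} (hK : 0 < K) :
    ∀ᶠ n : ℕ in atTop, K * Real.exp (α * n / 2) ^ t + 1 ≤ Real.exp (α * n / 2) / n := by
  have ho := isLittleO_pow_exp_pos_mul_atTop 1 (b := (1 - t) * α / 2)
    (by have := sub_pos.2 ht; positivity)
  have hev := (ho.comp_tendsto tendsto_natCast_atTop_atTop).bound (c := (K + 1)⁻¹) (by positivity)
  filter_upwards [hev, eventually_gt_atTop 0] with n hn hn0
  have hn0' : (0 : ℝ) < n := by exact_mod_cast hn0
  simp only [Function.comp, pow_one, Real.norm_eq_abs, abs_of_pos hn0', Real.abs_exp] at hn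
  rw [inv_mul_eq_div, le_div_iff₀ (by positivity)] at hn
  have hsplit : Real.exp (α * n / 2) =
      Real.exp (α * n / 2) ^ t * Real.exp ((1 - t) * α / 2 * n) := by
    rw [← Real.exp_mul, ← Real.exp_add]
    ring_nf
  have hone : 1 ≤ Real.exp (α * n / 2) ^ t :=
    Real.one_le_rpow (Real.one_le_exp (by positivity)) ht0
  rw [le_div_iff₀ hn0']
  calc _ ≤ (K * Real.exp (α * n / 2) ^ t + Real.exp (α * n / 2) ^ t) * n := by gcongr
    _ = Real.exp (α * n / 2) ^ t * (n * (K + 1)) := by ring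
    _ ≤ _ := by gcongr
    _ = _ := hsplit.symm

/-- Step 3 for the case `ρ = 1`: if `e^{αn/2}/n ≥ 2` for all `n ≥ N`, then
`dim_H Υ(α, N) ≥ 1/2`. -/
theorem statement11 (α : ℝ) (hα : 0 < α) (N : ℕ) (hN : 1 ≤ N)
    (hN2 : ∀ n : ℕ, N ≤ n → 2 ≤ Real.exp (α * n / 2) / n) :
    1 / 2 ≤ dimH
      {x : ℝ | x ∈ Ioo (0 : ℝ) 1 ∧ Irrational x ∧
        ∀ n : ℕ, N ≤ n →
          (Real.exp (-(α / 4)) < (pq x n : ℝ) / Real.exp (α * n / 2) ∧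
            (pq x n : ℝ) / Real.exp (α * n / 2) < Real.exp (-(α / 4)) + 1 / n)} := by
  obtain ⟨M, hM⟩ : ∃ M : ℕ → ℕ, ∀ i, M i =
      if N ≤ i + 1 then ⌈Real.exp (α * (i + 1 : ℕ) / 2) / (i + 1 : ℕ)⌉₊ - 1 else 1 :=
    ⟨_, fun _ => rfl⟩
  obtain ⟨b, hb⟩ : ∃ b : ℕ → ℕ, ∀ i, b i =
      if N ≤ i + 1 then ⌊Real.exp (-(α / 4)) * Real.exp (α * (i + 1 : ℕ) / 2)⌋₊ + 1 else 2 :=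
    ⟨_, fun _ => rfl⟩
  have hb_eq (i : ℕ) (hi : N ≤ i + 1) :
      b i = ⌊Real.exp (-(α / 4)) * Real.exp (α * (i + 1 : ℕ) / 2)⌋₊ + 1 := by rw [hb, if_pos hi]
  have hM_cast (i : ℕ) (hi : N ≤ i + 1) :
      (M i : ℝ) = ⌈Real.exp (α * (i + 1 : ℕ) / 2) / (i + 1 : ℕ)⌉₊ - 1 := by
    rw [hM, if_pos hi, Nat.cast_sub (Nat.one_le_ceil_iff.2 (by positivity)), Nat.cast_one]
  have hM_lt (i : ℕ) (hi : N ≤ i + 1) :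
      (M i : ℝ) < Real.exp (α * (i + 1 : ℕ) / 2) / (i + 1 : ℕ) := by
    have := Nat.ceil_lt_add_one
      (by positivity : 0 ≤ Real.exp (α * (i + 1 : ℕ) / 2) / (i + 1 : ℕ))
    rw [hM_cast i hi]
    linarith
  have hM_ge (i : ℕ) (hi : N ≤ i + 1) :
      Real.exp (α * (i + 1 : ℕ) / 2) / (i + 1 : ℕ) - 1 ≤ M i := by
    have := Nat.le_ceil (Real.exp (α * (i + 1 : ℕ) / 2) / (i + 1 : ℕ))
    rw [hM_cast i hi]
    linarith
  have hM1 (i : ℕ) : 1 ≤ M i := by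
    by_cases hi : N ≤ i + 1
    · have h1 := hM_ge i hi
      have h2 := hN2 (i + 1) hi
      exact_mod_cast (by linarith : (1 : ℝ) ≤ M i)
    · rw [hM, if_neg hi]
  have hb2 (i : ℕ) : 2 ≤ b i := by
    by_cases hi : N ≤ i + 1
    · rw [hb_eq i hi]
      refine Nat.succ_le_succ (Nat.le_floor ?_)
      rw [Nat.cast_one, ← Real.exp_add]
      refine Real.one_le_exp ?_
      push_cast
      have : (0 : ℝ) ≤ i := Nat.cast_nonneg i
      nlinarith
    · rw [hb, if_neg hi]
  have hsub : {x | ∃ d : ℕ → ℕ, (∀ i, d i < M i) ∧ cfValue (fun i => b i + d i) = x} ⊆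
      {x : ℝ | x ∈ Ioo (0 : ℝ) 1 ∧ Irrational x ∧
        ∀ n : ℕ, N ≤ n →
          (Real.exp (-(α / 4)) < (pq x n : ℝ) / Real.exp (α * n / 2) ∧
            (pq x n : ℝ) / Real.exp (α * n / 2) < Real.exp (-(α / 4)) + 1 / n)} := by
    rintro _ ⟨d, hd, rfl⟩
    have ha (i : ℕ) : 2 ≤ b i + d i := (hb2 i).trans (Nat.le_add_right _ _)
    refine ⟨⟨cfValue_pos ha, (cfValue_le_half ha).trans_lt (by norm_num)⟩,
      irrational_cfValue ha, fun n hn => ?_⟩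
    obtain ⟨i, rfl⟩ : ∃ i, n = i + 1 := ⟨n - 1, by omega⟩
    rw [pq_cfValue _ ha, Nat.add_sub_cancel, lt_div_iff₀ (Real.exp_pos _),
      div_lt_iff₀ (Real.exp_pos _), add_mul, one_div_mul_eq_div, hb_eq i hn]
    have h1 := Nat.floor_le
      (by positivity : 0 ≤ Real.exp (-(α / 4)) * Real.exp (α * (i + 1 : ℕ) / 2))
    have h2 := Nat.lt_floor_add_one (Real.exp (-(α / 4)) * Real.exp (α * (i + 1 : ℕ) / 2))
    have h3 := hM_lt i hn
    have h4 : (d i : ℝ) + 1 ≤ M i := by exact_mod_cast hd i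
    have h5 : (0 : ℝ) ≤ d i := Nat.cast_nonneg _
    push_cast at h1 h2 h3 ⊢
    constructor <;> linarith
  have hgrowth {t : ℝ} (ht0 : 0 < t) (ht1 : t < 1) :
      ∀ᶠ n in atTop, ((b (n + 1) : ℝ) + M (n + 1) + 1) ^ t ≤ M n := by
    have hev := (tendsto_add_atTop_nat 1).eventually
      (eventually_rpow_add_one_le_exp_div hα ht0.le ht1
        (K := (4 * Real.exp (α / 2)) ^ t) (by positivity))
    filter_upwards [hev, eventually_ge_atTop N] with n hn hnN
    have hM_lt' := hM_lt (n + 1) (by omega)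
    have hexp : Real.exp (α * (n + 1 + 1 : ℕ) / 2) =
        Real.exp (α / 2) * Real.exp (α * (n + 1 : ℕ) / 2) := by
      rw [← Real.exp_add]
      push_cast
      ring_nf
    have hone : 1 ≤ Real.exp (α * (n + 1 + 1 : ℕ) / 2) := Real.one_le_exp (by positivity)
    have hdiv : Real.exp (α * (n + 1 + 1 : ℕ) / 2) / (n + 1 + 1 : ℕ) ≤
        Real.exp (α * (n + 1 + 1 : ℕ) / 2) :=
      div_le_self (Real.exp_pos _).le (by exact_mod_cast (by omega : 1 ≤ n + 1 + 1))
    have hb_le : (b (n + 1) : ℝ) ≤ Real.exp (α * (n + 1 + 1 : ℕ) / 2) + 1 := by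
      rw [hb_eq (n + 1) (by omega), Nat.cast_add, Nat.cast_one]
      gcongr
      refine (Nat.floor_le (by positivity)).trans (mul_le_of_le_one_left (Real.exp_pos _).le ?_)
      exact Real.exp_le_one_iff.2 (by linarith)
    calc ((b (n + 1) : ℝ) + M (n + 1) + 1) ^ t
        ≤ (4 * Real.exp (α / 2) * Real.exp (α * (n + 1 : ℕ) / 2)) ^ t :=
          Real.rpow_le_rpow (by positivity) (by rw [mul_assoc, ← hexp]; linarith) ht0.le
      _ = (4 * Real.exp (α / 2)) ^ t * Real.exp (α * (n + 1 : ℕ) / 2) ^ t :=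
          Real.mul_rpow (by positivity) (by positivity)
      _ ≤ _ := (le_sub_iff_add_le.2 hn).trans (hM_ge n (by omega))
  have hhalf : Tendsto (fun t : ℝ => ENNReal.ofReal (t / 2)) (nhdsWithin 1 (Iio 1))
      (nhds (1 / 2)) := by
    have : ENNReal.ofReal (1 / 2) = 1 / 2 := by
      rw [ENNReal.ofReal_div_of_pos two_pos, ENNReal.ofReal_one, ENNReal.ofReal_ofNat]
    rw [← this]
    exact ((ENNReal.continuous_ofReal.comp (continuous_id.div_const 2)).tendsto 1).mono_left
      nhdsWithin_le_nhds
  refine le_of_tendsto hhalf ?_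
  filter_upwards [Ioo_mem_nhdsLT (zero_lt_one' ℝ)] with t ht
  exact (ofReal_half_le_dimH_cfValue hb2 hM1 ht.1 (hgrowth ht.1 ht.2)).trans (dimH_mono hsub)
end

section
/- Let c ∈ (0,∞) and let ψ(n) = e^{c⌊√n⌋}. Then for every δ ∈ (0,c), L(ψ) ⊆ Γ(c − δ). -/
open Filter Set
open scoped ENNReal

open scoped Classical in
/-- `Π_n^{(m)}(x)`: the product of `a_i(x) a_{i+1}(x)` over those `1 ≤ i ≤ n` with
`a_i(x) a_{i+1}(x) > e^m`. -/
noncomputable def Pimn (x : ℝ) (m n : ℕ) : ℕ :=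
  ∏ i ∈ Finset.Icc 1 n,
    if Real.exp m < (pq x i * pq x (i + 1) : ℕ) then pq x i * pq x (i + 1) else 1

/-- `Γ_{m,n}(c) = {x ∈ (0,1) irrational : Π_n^{(m)}(x) > e^{cn/2}}`. -/
def GammaMN (c : ℝ) (m n : ℕ) : Set ℝ :=
  {x | x ∈ Set.Ioo (0 : ℝ) 1 ∧ Irrational x ∧ Real.exp (c * n / 2) < (Pimn x m n : ℝ)}

/-- `Γ_m(c)`: the set of `x` belonging to `Γ_{m,n}(c)` for infinitely many `n`. -/
def GammaM (c : ℝ) (m : ℕ) : Set ℝ :=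
  {x | ∃ᶠ n : ℕ in Filter.atTop, x ∈ GammaMN c m n}

/-- `Γ(c) = ∩_{m ≥ 0} Γ_m(c)`. -/
def Gamma (c : ℝ) : Set ℝ := ⋂ m : ℕ, GammaM c m

theorem Lmax_succ (x : ℝ) (n : ℕ) :
    Lmax x (n + 1) = max (Lmax x n) (pq x (n + 1) * pq x (n + 2)) := by
  unfold Lmax
  rw [← Finset.insert_Icc_right_eq_Icc_add_one (by omega), Finset.sup_insert, max_comm]

open scoped Classical in
theorem one_le_ite_of_exp_lt (m k : ℕ) : 1 ≤ if Real.exp m < k then k else 1 := by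
  split_ifs with h
  · exact_mod_cast (Real.one_le_exp (Nat.cast_nonneg m)).trans h.le
  · exact le_rfl

theorem one_le_Pimn (x : ℝ) (m n : ℕ) : 1 ≤ Pimn x m n := by
  exact Finset.one_le_prod' fun i _ => one_le_ite_of_exp_lt m _

theorem Pimn_mul_le {x : ℝ} {m n l : ℕ} (hnl : n < l)
    (hl : Real.exp m < (pq x l * pq x (l + 1) : ℕ)) :
    Pimn x m n * (pq x l * pq x (l + 1)) ≤ Pimn x m l := by
  obtain ⟨l, rfl⟩ : ∃ k, l = k + 1 := ⟨l - 1, by omega⟩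
  have h1 : Pimn x m n ≤ Pimn x m l := by
    exact Finset.prod_le_prod_of_subset_of_one_le'
      (Finset.Icc_subset_Icc_right (by omega)) fun i _ _ => one_le_ite_of_exp_lt m _
  have h2 : Pimn x m (l + 1) = Pimn x m l * (pq x (l + 1) * pq x (l + 1 + 1)) := by
    unfold Pimn
    rw [Finset.prod_Icc_succ_top (by omega), if_pos hl]
  rw [h2]
  exact Nat.mul_le_mul_right _ h1

/-- If `L_n(x) ~ e^{c⌊√n⌋}`, then the maximum `L_n(x)` is attained at `i = n` for every large
perfect square `n`, which bounds `a_n(x) a_{n+1}(x)` from below. -/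
theorem eventually_exp_le_pq_mul_pq_sq {c : ℝ} (hc : 0 < c) {x : ℝ}
    (h : Tendsto (fun n : ℕ => (Lmax x n : ℝ) / Real.exp (c * Nat.sqrt n)) atTop (nhds 1)) :
    ∀ᶠ j : ℕ in atTop,
      Real.exp (c * j) ≤ ((pq x ((j + 1) ^ 2) * pq x ((j + 1) ^ 2 + 1) : ℕ) : ℝ) := by
  have h1 := h.eventually (Ioo_mem_nhds
    (Real.exp_lt_one_iff.2 (by linarith : -(c / 3) < 0))
    (Real.one_lt_exp_iff.2 (by linarith : 0 < c / 3)))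
  obtain ⟨A, hA⟩ := eventually_atTop.1 h1
  filter_upwards [eventually_ge_atTop A] with j hj
  have hs1 : Nat.sqrt (j ^ 2 + 2 * j) = j := by
    rw [eq_comm, Nat.eq_sqrt]
    constructor <;> nlinarith
  have hs2 : Nat.sqrt (j ^ 2 + 2 * j + 1) = j + 1 := by
    rw [show j ^ 2 + 2 * j + 1 = (j + 1) ^ 2 by ring, Nat.sqrt_eq']
  have hu := (hA (j ^ 2 + 2 * j) (by nlinarith)).2
  have hl := (hA (j ^ 2 + 2 * j + 1) (by nlinarith)).1
  rw [hs1, div_lt_iff₀ (Real.exp_pos _), ← Real.exp_add] at hu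
  rw [hs2, lt_div_iff₀ (Real.exp_pos _), ← Real.exp_add] at hl
  push_cast at hl
  have hlt : Lmax x (j ^ 2 + 2 * j) < Lmax x (j ^ 2 + 2 * j + 1) := by
    have := (hu.trans_le (Real.exp_le_exp.2
      (by linarith : c / 3 + c * j ≤ -(c / 3) + c * (j + 1)))).trans hl
    exact_mod_cast this
  have heq := Lmax_succ x (j ^ 2 + 2 * j)
  rw [show (j + 1) ^ 2 = j ^ 2 + 2 * j + 1 by ring]
  have : Lmax x (j ^ 2 + 2 * j + 1)
      = pq x (j ^ 2 + 2 * j + 1) * pq x (j ^ 2 + 2 * j + 1 + 1) := by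
    rcases max_choice (Lmax x (j ^ 2 + 2 * j))
      (pq x (j ^ 2 + 2 * j + 1) * pq x (j ^ 2 + 2 * j + 2)) with h | h
    · omega
    · rw [heq, h]
  rw [← this]
  exact (Real.exp_le_exp.2 (by linarith)).trans hl.le

/-- A lower bound for `Π^{(m)}` along perfect squares. -/
theorem exp_le_Pimn_sq {c : ℝ} {x : ℝ} {m K : ℕ}
    (hm : ∀ j : ℕ, K ≤ j → (m : ℝ) < c * j)
    (h : ∀ j : ℕ, K ≤ j →
      Real.exp (c * j) ≤ ((pq x ((j + 1) ^ 2) * pq x ((j + 1) ^ 2 + 1) : ℕ) : ℝ))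
    {N : ℕ} (hN : K ≤ N) :
    Real.exp (c * (N * (N - 1) - K * (K - 1)) / 2) ≤ (Pimn x m (N ^ 2) : ℝ) := by
  induction N, hN using Nat.le_induction with
  | base => simpa using one_le_Pimn x m (K ^ 2)
  | succ N hN ih =>
    have h1 := Pimn_mul_le (x := x) (m := m) (n := N ^ 2) (l := (N + 1) ^ 2) (by nlinarith)
      ((Real.exp_lt_exp.2 (hm N hN)).trans_le (h N hN))
    calc Real.exp (c * ((N + 1 : ℕ) * ((N + 1 : ℕ) - 1) - K * (K - 1)) / 2)
        = Real.exp (c * (N * (N - 1) - K * (K - 1)) / 2) * Real.exp (c * N) := by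
          rw [← Real.exp_add]; push_cast; ring_nf
      _ ≤ (Pimn x m (N ^ 2) : ℝ) *
          ((pq x ((N + 1) ^ 2) * pq x ((N + 1) ^ 2 + 1) : ℕ) : ℝ) := by
          gcongr
          exact h N hN
      _ ≤ _ := by exact_mod_cast h1

/-- Proposition 5.2: for `ψ(n) = e^{c⌊√n⌋}` and any `δ ∈ (0, c)`,
`L(ψ) ⊆ Γ(c - δ)`. -/
theorem statement13 (c : ℝ) (hc : 0 < c) (δ : ℝ) (hδ0 : 0 < δ) (hδc : δ < c) :
    (Lset fun n : ℕ => Real.exp (c * Nat.sqrt n)) ⊆ Gamma (c - δ) := by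
  rintro x ⟨hx, hirr, hlim⟩
  refine mem_iInter.2 fun m => frequently_atTop.2 fun a => ?_
  have hlarge : ∀ᶠ j : ℕ in atTop, (m : ℝ) < c * j :=
    (tendsto_natCast_atTop_atTop.const_mul_atTop hc).eventually_gt_atTop _
  obtain ⟨K, hK⟩ := eventually_atTop.1 (hlarge.and (eventually_exp_le_pq_mul_pq_sq hc hlim))
  have hδ : ∀ᶠ j : ℕ in atTop, c + c * K ^ 2 < δ * j :=
    (tendsto_natCast_atTop_atTop.const_mul_atTop hδ0).eventually_gt_atTop _
  obtain ⟨N, hNδ, hNK, hNa, hN1⟩ := (hδ.and ((eventually_ge_atTop K).and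
    ((eventually_ge_atTop a).and (eventually_ge_atTop 1)))).exists
  refine ⟨N ^ 2, by nlinarith, hx, hirr, lt_of_lt_of_le (Real.exp_lt_exp.2 ?_)
    (exp_le_Pimn_sq (fun j hj => (hK j hj).1) (fun j hj => (hK j hj).2) hNK)⟩
  have hN1' : (1 : ℝ) ≤ N := by exact_mod_cast hN1
  have h1 : (c + c * K ^ 2) * N < δ * N * N := by gcongr
  have h2 : c * K ^ 2 * 1 ≤ c * K ^ 2 * N := by gcongr
  have h3 : 0 ≤ c * K := by positivity
  push_cast
  nlinarith
end
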